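/- (Lemma: uniform control of I − η∇²f) Fix any constant c₀ > 1 and assume ‖x^♮‖₂ = 1. Suppose m > c₁ n log³ m for some sufficiently large constant c₁ > 0 and a_i ~ N(0, I_n) i.i.d. Then with probability exceeding 1 − O(m^{−10}), for all z ∈ ℝ^n obeying max_{1≤i≤m} |a_i^⊤ z| ≤ c₀ √(log m) ‖z‖₂ and all stepsizes 0 < η < c₂ / max{‖z‖₂², 1} with c₂ > 0 a sufficiently small constant: ‖(I_n − η ∇²f(z)) − {(1 − 3η‖z‖₂² + η) I_n + 2η x^♮ x^♮⊤ − 6η z z^⊤}‖ ≲ √(n log³ m / m) · max{‖z‖₂², 1}, and moreover ‖∇²f(z)‖ ≤ 10‖z‖₂² + 4 (operator norms). -/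

import Mathlib

open MeasureTheory ProbabilityTheory Finset

noncomputable section

namespace PR

/-- Euclidean (ℓ²) norm on `Fin N → ℝ`. -/
def nrm {N : ℕ} (x : Fin N → ℝ) : ℝ := Real.sqrt (∑ j, x j ^ 2)

/-- Euclidean inner product on `Fin N → ℝ`. -/
def dotp {N : ℕ} (x y : Fin N → ℝ) : ℝ := ∑ j, x j * y j

/-- Standard Gaussian `N(0, I_N)` on `ℝ^N`, realized as i.i.d. standard normal coordinates. -/
def stdGaussian (N : ℕ) : Measure (Fin N → ℝ) := Measure.pi fun _ => gaussianReal 0 1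

/-- Law of `m` i.i.d. `N(0, I_N)` design vectors. -/
def design (m N : ℕ) : Measure (Fin m → Fin N → ℝ) := Measure.pi fun _ => stdGaussian N

/-- Gradient of the empirical loss `f_S(x) = (1/(4m)) ∑_{i ∈ S} [(aᵢᵀx)² − (aᵢᵀx♮)²]²`,
restricted to the samples in `S`. -/
def grad {m N : ℕ} (S : Finset (Fin m)) (a : Fin m → Fin N → ℝ) (xs x : Fin N → ℝ) :
    Fin N → ℝ :=
  (m : ℝ)⁻¹ • ∑ i ∈ S, ((dotp (a i) x ^ 2 - dotp (a i) xs ^ 2) * dotp (a i) x) • a i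

/-- Gradient descent iterates with constant stepsize `η`, started at `x0`, using samples in `S`. -/
def iter {m N : ℕ} (S : Finset (Fin m)) (a : Fin m → Fin N → ℝ) (xs : Fin N → ℝ) (η : ℝ)
    (x0 : Fin N → ℝ) : ℕ → Fin N → ℝ
  | 0 => x0
  | t + 1 => iter S a xs η x0 t - η • grad S a xs (iter S a xs η x0 t)

/-- Distance modulo the global sign ambiguity. -/
def pdist {N : ℕ} (x z : Fin N → ℝ) : ℝ := min (nrm (x - z)) (nrm (x + z))

end PR

namespace PR

/-- The spectral (ℓ² operator) norm of a square matrix. -/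
def opN {N : ℕ} (M : Matrix (Fin N) (Fin N) ℝ) : ℝ :=
  ‖LinearMap.toContinuousLinearMap (Matrix.toEuclideanLin M)‖

/-- The rank-one matrix `x xᵀ`. -/
def outer {N : ℕ} (x : Fin N → ℝ) : Matrix (Fin N) (Fin N) ℝ :=
  Matrix.of fun p q => x p * x q

/-- The Hessian `∇²f(z) = (1/m) ∑ᵢ [3(aᵢᵀz)² − (aᵢᵀx♮)²] aᵢaᵢᵀ` of the empirical loss. -/
def hess {m N : ℕ} (a : Fin m → Fin N → ℝ) (xs z : Fin N → ℝ) :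
    Matrix (Fin N) (Fin N) ℝ :=
  Matrix.of fun p q =>
    (m : ℝ)⁻¹ * ∑ i, (3 * PR.dotp (a i) z ^ 2 - PR.dotp (a i) xs ^ 2) * a i p * a i q

end PR

namespace PR

section QuadraticForm

variable {N : ℕ}

lemma nrm_nonneg (x : Fin N → ℝ) : 0 ≤ nrm x := Real.sqrt_nonneg _

lemma nrm_sq (x : Fin N → ℝ) : nrm x ^ 2 = ∑ j, x j ^ 2 :=
  Real.sq_sqrt (Finset.sum_nonneg fun _ _ => sq_nonneg _)

lemma nrm_eq_zero {x : Fin N → ℝ} (h : nrm x = 0) : x = 0 := by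
  have h' := nrm_sq x
  rw [h, zero_pow two_ne_zero, eq_comm, Finset.sum_eq_zero_iff_of_nonneg fun _ _ => sq_nonneg _] at h'
  ext j
  simpa using h' j (Finset.mem_univ j)

lemma nrm_smul (c : ℝ) (x : Fin N → ℝ) : nrm (c • x) = |c| * nrm x := by
  simp only [nrm, Pi.smul_apply, smul_eq_mul, mul_pow, ← Finset.mul_sum]
  rw [Real.sqrt_mul (sq_nonneg c), Real.sqrt_sq_eq_abs]

lemma dotp_smul (c : ℝ) (x y : Fin N → ℝ) : dotp x (c • y) = c * dotp x y := by
  simp only [dotp, Pi.smul_apply, smul_eq_mul, Finset.mul_sum]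
  exact Finset.sum_congr rfl fun _ _ => by ring

lemma dotp_add (x y z : Fin N → ℝ) : dotp x (y + z) = dotp x y + dotp x z := by
  simp only [dotp, Pi.add_apply, mul_add, Finset.sum_add_distrib]

lemma dotp_sub (x y z : Fin N → ℝ) : dotp x (y - z) = dotp x y - dotp x z := by
  simp only [dotp, Pi.sub_apply, mul_sub, Finset.sum_sub_distrib]

lemma dotp_self (x : Fin N → ℝ) : dotp x x = nrm x ^ 2 := by
  rw [nrm_sq]
  exact Finset.sum_congr rfl fun _ _ => by ring

lemma dotp_smul_left (c : ℝ) (x y : Fin N → ℝ) : dotp (c • x) y = c * dotp x y := by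
  simp only [dotp, Pi.smul_apply, smul_eq_mul, Finset.mul_sum]
  exact Finset.sum_congr rfl fun _ _ => by ring

lemma dotp_sq_le (x y : Fin N → ℝ) : dotp x y ^ 2 ≤ nrm x ^ 2 * nrm y ^ 2 := by
  rw [nrm_sq, nrm_sq]
  exact Finset.sum_mul_sq_le_sq_mul_sq _ _ _

/-- The quadratic form `uᵀ M u`. -/
def quad (M : Matrix (Fin N) (Fin N) ℝ) (u : Fin N → ℝ) : ℝ := u ⬝ᵥ M.mulVec u

lemma opN_le_of_quad_le {M : Matrix (Fin N) (Fin N) ℝ} (hM : M.IsSymm) {C : ℝ} (hC : 0 ≤ C)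
    (h : ∀ u, |quad M u| ≤ C * nrm u ^ 2) : opN M ≤ C := by
  have hsymm : (LinearMap.toContinuousLinearMap (Matrix.toEuclideanLin M)).IsSymmetric := by
    have hH : M.IsHermitian := by
      rw [Matrix.IsHermitian, Matrix.conjTranspose_eq_transpose_of_trivial]
      exact hM
    exact Matrix.isSymmetric_toEuclideanLin_iff.2 hH
  rw [opN, ContinuousLinearMap.norm_eq_iSup_rayleighQuotient _ hsymm]
  refine ciSup_le fun x => ?_
  have hq : ContinuousLinearMap.reApplyInnerSelf
      (LinearMap.toContinuousLinearMap (Matrix.toEuclideanLin M)) x = quad M x.ofLp := by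
    simp [ContinuousLinearMap.reApplyInnerSelf_apply, quad, EuclideanSpace.inner_eq_star_dotProduct,
      Matrix.toLpLin_apply]
  have hn : ‖x‖ ^ 2 = nrm x.ofLp ^ 2 := by
    rw [nrm_sq, EuclideanSpace.norm_sq_eq]
    simp
  rw [ContinuousLinearMap.rayleighQuotient, hq, hn, abs_div, abs_of_nonneg (sq_nonneg (nrm x.ofLp))]
  exact div_le_of_le_mul₀ (sq_nonneg _) hC (h _)

lemma quad_one (u : Fin N → ℝ) : quad 1 u = nrm u ^ 2 := by
  simp [quad, nrm_sq, dotProduct, ← sq]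

lemma quad_add (A B : Matrix (Fin N) (Fin N) ℝ) (u : Fin N → ℝ) :
    quad (A + B) u = quad A u + quad B u := by
  simp [quad, Matrix.add_mulVec, dotProduct_add]

lemma quad_sub (A B : Matrix (Fin N) (Fin N) ℝ) (u : Fin N → ℝ) :
    quad (A - B) u = quad A u - quad B u := by
  simp [quad, Matrix.sub_mulVec, dotProduct_sub]

lemma quad_smul (c : ℝ) (A : Matrix (Fin N) (Fin N) ℝ) (u : Fin N → ℝ) :
    quad (c • A) u = c * quad A u := by
  simp [quad, Matrix.smul_mulVec]

lemma quad_outer (x u : Fin N → ℝ) : quad (outer x) u = dotp x u ^ 2 := by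
  rw [sq, dotp, Finset.sum_mul_sum]
  simp only [quad, dotProduct, Matrix.mulVec, outer, Matrix.of_apply, Finset.mul_sum]
  exact Finset.sum_congr rfl fun _ _ => Finset.sum_congr rfl fun _ _ => by ring

/-- The empirical fourth-order form `(1/m) ∑ᵢ (aᵢᵀz)² (aᵢᵀu)²`. -/
def quartic {m : ℕ} (a : Fin m → Fin N → ℝ) (z u : Fin N → ℝ) : ℝ :=
  (m : ℝ)⁻¹ * ∑ i, dotp (a i) z ^ 2 * dotp (a i) u ^ 2

/-- The expectation `‖z‖²‖u‖² + 2 (zᵀu)²` of the fourth-order form. -/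
def quarticMean (z u : Fin N → ℝ) : ℝ := nrm z ^ 2 * nrm u ^ 2 + 2 * dotp z u ^ 2

lemma hess_eq_smul_sum {m : ℕ} (a : Fin m → Fin N → ℝ) (xs z : Fin N → ℝ) :
    hess a xs z =
      (m : ℝ)⁻¹ • ∑ i, (3 * dotp (a i) z ^ 2 - dotp (a i) xs ^ 2) • outer (a i) := by
  ext p q
  simp [hess, outer, Matrix.sum_apply, mul_assoc]

lemma quad_sum {ι : Type*} (s : Finset ι) (A : ι → Matrix (Fin N) (Fin N) ℝ) (u : Fin N → ℝ) :
    quad (∑ i ∈ s, A i) u = ∑ i ∈ s, quad (A i) u := by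
  simp [quad, Matrix.sum_mulVec, dotProduct_sum]

lemma quad_hess {m : ℕ} (a : Fin m → Fin N → ℝ) (xs z u : Fin N → ℝ) :
    quad (hess a xs z) u = 3 * quartic a z u - quartic a xs u := by
  simp only [hess_eq_smul_sum, quad_smul, quad_sum, quad_outer, quartic, sub_mul,
    Finset.sum_sub_distrib, mul_assoc, ← Finset.mul_sum]
  ring

lemma outer_isSymm (x : Fin N → ℝ) : (outer x).IsSymm := by
  ext p q
  simp [outer, mul_comm]

lemma hess_isSymm {m : ℕ} (a : Fin m → Fin N → ℝ) (xs z : Fin N → ℝ) : (hess a xs z).IsSymm := by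
  ext p q
  simp only [Matrix.transpose_apply, hess, Matrix.of_apply, mul_right_comm]

lemma quartic_smul {m : ℕ} (a : Fin m → Fin N → ℝ) (c d : ℝ) (z u : Fin N → ℝ) :
    quartic a (c • z) (d • u) = c ^ 2 * d ^ 2 * quartic a z u := by
  simp only [quartic, dotp_smul, mul_pow, Finset.mul_sum]
  exact Finset.sum_congr rfl fun _ _ => by ring

lemma quarticMean_smul (c d : ℝ) (z u : Fin N → ℝ) :
    quarticMean (c • z) (d • u) = c ^ 2 * d ^ 2 * quarticMean z u := by
  simp only [quarticMean, dotp_smul, dotp_smul_left, nrm_smul, mul_pow, sq_abs]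
  ring

lemma quarticMean_nonneg (z u : Fin N → ℝ) : 0 ≤ quarticMean z u := by
  unfold quarticMean; positivity

lemma quarticMean_le (z u : Fin N → ℝ) : quarticMean z u ≤ 3 * nrm z ^ 2 * nrm u ^ 2 := by
  have := dotp_sq_le z u
  unfold quarticMean
  linarith

/-- A deviation bound for incoherent vectors in the unit ball extends to all incoherent vectors. -/
lemma abs_quartic_sub_le_of_unit {m : ℕ} {a : Fin m → Fin N → ℝ} {R δ : ℝ}
    (H : ∀ z u : Fin N → ℝ, nrm z ≤ 1 → nrm u ≤ 1 → (∀ i, |dotp (a i) z| ≤ R) →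
      |quartic a z u - quarticMean z u| ≤ δ)
    (z u : Fin N → ℝ) (hz : ∀ i, |dotp (a i) z| ≤ R * nrm z) :
    |quartic a z u - quarticMean z u| ≤ δ * nrm z ^ 2 * nrm u ^ 2 := by
  rcases (nrm_nonneg z).eq_or_lt with h0 | hzp
  · have := nrm_eq_zero h0.symm
    subst this
    simp [quartic, quarticMean, dotp, nrm]
  rcases (nrm_nonneg u).eq_or_lt with h0 | hup
  · have := nrm_eq_zero h0.symm
    subst this
    simp [quartic, quarticMean, dotp, nrm]
  have key := H ((nrm z)⁻¹ • z) ((nrm u)⁻¹ • u)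
    (by rw [nrm_smul, abs_of_pos (inv_pos.2 hzp), inv_mul_cancel₀ hzp.ne'])
    (by rw [nrm_smul, abs_of_pos (inv_pos.2 hup), inv_mul_cancel₀ hup.ne'])
    (fun i => by
      rw [dotp_smul, abs_mul, abs_of_pos (inv_pos.2 hzp), inv_mul_le_iff₀ hzp, mul_comm]
      exact hz i)
  rw [quartic_smul, quarticMean_smul, ← mul_sub, abs_mul, abs_of_nonneg (by positivity)] at key
  have h2 : 0 < nrm z ^ 2 * nrm u ^ 2 := by positivity
  rw [inv_pow, inv_pow, ← mul_inv, inv_mul_le_iff₀ h2] at key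
  linarith

/-- The deterministic consequence of the deviation bound for the fourth-order form. -/
lemma hess_control {m : ℕ} {a : Fin m → Fin N → ℝ} {xs z : Fin N → ℝ} {δ : ℝ} (hδ : 0 ≤ δ)
    (hδ1 : 4 * δ ≤ 1) (hxs : nrm xs = 1)
    (hz : ∀ u, |quartic a z u - quarticMean z u| ≤ δ * nrm z ^ 2 * nrm u ^ 2)
    (hx : ∀ u, |quartic a xs u - quarticMean xs u| ≤ δ * nrm xs ^ 2 * nrm u ^ 2) :
    (∀ η : ℝ, 0 < η → η < 1 / max (nrm z ^ 2) 1 →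
      opN (((1 : Matrix (Fin N) (Fin N) ℝ) - η • hess a xs z) -
          ((1 - 3 * η * nrm z ^ 2 + η) • (1 : Matrix (Fin N) (Fin N) ℝ) +
            (2 * η) • outer xs - (6 * η) • outer z)) ≤ 4 * δ * max (nrm z ^ 2) 1) ∧
    opN (hess a xs z) ≤ 10 * nrm z ^ 2 + 4 := by
  have hzn := sq_nonneg (nrm z)
  constructor
  · intro η hη hη2
    have hη1 : η ≤ 1 := hη2.le.trans (div_le_one_of_le₀ (le_max_right _ _) (by positivity))
    refine opN_le_of_quad_le ?_ (by positivity) fun u => ?_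
    · exact ((Matrix.isSymm_one).sub ((hess_isSymm a xs z).smul η)).sub
        ((((Matrix.isSymm_one).smul _).add ((outer_isSymm xs).smul _)).sub ((outer_isSymm z).smul _))
    · have e : quad (((1 : Matrix (Fin N) (Fin N) ℝ) - η • hess a xs z) -
          ((1 - 3 * η * nrm z ^ 2 + η) • (1 : Matrix (Fin N) (Fin N) ℝ) +
            (2 * η) • outer xs - (6 * η) • outer z)) u =
          η * ((quartic a xs u - quarticMean xs u) - 3 * (quartic a z u - quarticMean z u)) := by
        simp only [quad_sub, quad_add, quad_smul, quad_one, quad_outer, quad_hess, quarticMean, hxs]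
        ring
      rw [e, abs_mul, abs_of_pos hη]
      have h1 := hz u
      have h2 := hx u
      rw [hxs] at h2
      have h3 : |(quartic a xs u - quarticMean xs u) - 3 * (quartic a z u - quarticMean z u)|
          ≤ 4 * δ * max (nrm z ^ 2) 1 * nrm u ^ 2 := by
        have m1 : δ * nrm u ^ 2 * nrm z ^ 2 ≤ δ * nrm u ^ 2 * max (nrm z ^ 2) 1 :=
          mul_le_mul_of_nonneg_left (le_max_left _ _) (by positivity)
        have m2 : δ * nrm u ^ 2 * 1 ≤ δ * nrm u ^ 2 * max (nrm z ^ 2) 1 :=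
          mul_le_mul_of_nonneg_left (le_max_right _ _) (by positivity)
        rw [abs_le] at h1 h2 ⊢
        constructor <;> nlinarith
      exact (mul_le_of_le_one_left (abs_nonneg _) hη1).trans h3
  · refine opN_le_of_quad_le (hess_isSymm a xs z) (by positivity) fun u => ?_
    rw [quad_hess]
    have h1 := hz u
    have h2 := hx u
    have h3 := quarticMean_le z u
    have h4 := quarticMean_le xs u
    have h5 := quarticMean_nonneg z u
    have h6 := quarticMean_nonneg xs u
    rw [hxs] at h2 h4
    have hu := sq_nonneg (nrm u)
    have m1 : δ * nrm z ^ 2 * nrm u ^ 2 ≤ 1 / 4 * nrm z ^ 2 * nrm u ^ 2 := by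
      gcongr; linarith
    have m2 : δ * 1 ^ 2 * nrm u ^ 2 ≤ 1 / 4 * nrm u ^ 2 := by
      rw [one_pow, mul_one]; gcongr; linarith
    have m3 : 0 ≤ nrm z ^ 2 * nrm u ^ 2 := by positivity
    rw [abs_le] at h1 h2 ⊢
    constructor <;> nlinarith

end QuadraticForm

section Gaussian

variable {N : ℕ}

instance : IsProbabilityMeasure (PR.stdGaussian N) := by
  unfold PR.stdGaussian; infer_instance

instance (m : ℕ) : IsProbabilityMeasure (design m N) := by
  unfold design; infer_instance

lemma measurable_dotp (w : Fin N → ℝ) : Measurable fun a : Fin N → ℝ => dotp a w := by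
  unfold dotp; fun_prop

lemma map_dotp_stdGaussian (w : Fin N → ℝ) :
    (PR.stdGaussian N).map (fun a => dotp a w) =
      (gaussianReal 0 1).map (fun g => nrm w * g) := by
  have := Measure.isProbabilityMeasure_map (μ := PR.stdGaussian N) (measurable_dotp w).aemeasurable
  rw [gaussianReal_map_const_mul]
  refine Measure.ext_of_charFun (funext fun t => ?_)
  rw [charFun_gaussianReal, charFun_apply_real,
    integral_map (measurable_dotp w).aemeasurable (by fun_prop)]
  have e : ∀ a : Fin N → ℝ, Complex.exp (t * (dotp a w : ℝ) * Complex.I) =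
      ∏ j, Complex.exp ((t * w j : ℝ) * (a j : ℝ) * Complex.I) := by
    intro a
    rw [← Complex.exp_sum, dotp]
    congr 1
    push_cast
    rw [Finset.mul_sum, Finset.sum_mul]
    exact Finset.sum_congr rfl fun _ _ => by ring
  simp_rw [e]
  rw [PR.stdGaussian, integral_fintype_prod_eq_prod
    (f := fun j (x : ℝ) => Complex.exp ((t * w j : ℝ) * (x : ℝ) * Complex.I))]
  simp_rw [← charFun_apply_real, charFun_gaussianReal]
  rw [← Complex.exp_sum]
  congr 1
  simp only [NNReal.coe_one, Complex.ofReal_one, Complex.ofReal_zero, mul_zero, zero_mul, zero_sub,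
    mul_one, NNReal.coe_mk]
  rw [nrm_sq]
  push_cast
  rw [Finset.sum_neg_distrib, ← Finset.sum_div, Finset.sum_mul]
  congr 2
  exact Finset.sum_congr rfl fun _ _ => by ring

lemma integral_comp_dotp (w : Fin N → ℝ) {f : ℝ → ℝ} (hf : Measurable f) :
    ∫ a, f (dotp a w) ∂(PR.stdGaussian N) = ∫ g, f (nrm w * g) ∂(gaussianReal 0 1) := by
  rw [← integral_map (μ := PR.stdGaussian N) (measurable_dotp w).aemeasurable
    hf.aestronglyMeasurable, map_dotp_stdGaussian,
    integral_map (by fun_prop) hf.aestronglyMeasurable]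

lemma integrable_comp_dotp (w : Fin N → ℝ) {f : ℝ → ℝ} (hf : Measurable f)
    (h : Integrable (fun g => f (nrm w * g)) (gaussianReal 0 1)) :
    Integrable (fun a => f (dotp a w)) (PR.stdGaussian N) := by
  have h1 : Integrable f ((gaussianReal 0 1).map (fun g => nrm w * g)) :=
    (integrable_map_measure hf.aestronglyMeasurable (by fun_prop)).2 h
  rw [← map_dotp_stdGaussian] at h1
  exact (integrable_map_measure hf.aestronglyMeasurable (measurable_dotp w).aemeasurable).1 h1

lemma gaussianPDFReal_mul_exp_sq (x : ℝ) :
    gaussianPDFReal 0 1 x • Real.exp (x ^ 2 / 4) =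
      (√(2 * Real.pi))⁻¹ * Real.exp (-(1 / 4) * x ^ 2) := by
  rw [gaussianPDFReal, smul_eq_mul, mul_assoc, ← Real.exp_add]
  simp only [NNReal.coe_one, mul_one, sub_zero]
  congr 2
  ring

lemma integrable_exp_sq_gaussianReal :
    Integrable (fun x : ℝ => Real.exp (x ^ 2 / 4)) (gaussianReal 0 1) := by
  rw [gaussianReal_of_var_ne_zero _ one_ne_zero, integrable_withDensity_iff_integrable_smul']
  · simp_rw [toReal_gaussianPDF, gaussianPDFReal_mul_exp_sq]
    exact (integrable_exp_neg_mul_sq (by norm_num)).const_mul _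
  · exact measurable_gaussianPDF _ _
  · exact Filter.Eventually.of_forall fun _ => gaussianPDF_lt_top

lemma integral_exp_sq_gaussianReal_le :
    ∫ x : ℝ, Real.exp (x ^ 2 / 4) ∂(gaussianReal 0 1) ≤ 2 := by
  rw [integral_gaussianReal_eq_integral_smul one_ne_zero]
  simp_rw [gaussianPDFReal_mul_exp_sq]
  rw [integral_const_mul, integral_gaussian, ← Real.sqrt_inv, ← Real.sqrt_mul (by positivity)]
  refine Real.sqrt_le_iff.2 ⟨by norm_num, ?_⟩
  have := Real.pi_pos
  field_simp
  norm_num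

lemma integral_pow_four_gaussianReal : ∫ x : ℝ, x ^ 4 ∂(gaussianReal 0 1) = 3 := by
  have h := iteratedDeriv_mgf_zero (X := fun x : ℝ => x) (μ := gaussianReal 0 1) (by simp) 4
  have h' : (gaussianReal 0 1)[(fun x : ℝ => x) ^ 4] = ∫ x : ℝ, x ^ 4 ∂(gaussianReal 0 1) := rfl
  rw [← h', ← h, mgf_fun_id_gaussianReal]
  have d : ∀ (p : ℝ → ℝ) (p' : ℝ → ℝ), (∀ t, HasDerivAt p (p' t) t) →
      deriv (fun t => p t * Real.exp (t ^ 2 / 2)) =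
        fun t => (p' t + p t * t) * Real.exp (t ^ 2 / 2) := by
    intro p p' hp
    ext t
    have h1 : HasDerivAt (fun t : ℝ => Real.exp (t ^ 2 / 2)) (Real.exp (t ^ 2 / 2) * t) t := by
      have := (((hasDerivAt_id t).pow 2).div_const 2).exp
      simpa using this
    rw [((hp t).fun_mul h1).deriv]
    ring
  have e0 : (fun t : ℝ => Real.exp (0 * t + ((1 : NNReal) : ℝ) * t ^ 2 / 2)) =
      fun t => (fun _ => (1 : ℝ)) t * Real.exp (t ^ 2 / 2) := by
    ext t; simp
  rw [e0, iteratedDeriv_eq_iterate]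
  simp only [Function.iterate_succ, Function.iterate_zero, Function.comp_apply, id_eq]
  rw [d (fun _ => 1) (fun _ => 0) (fun t => hasDerivAt_const t 1)]
  simp only [zero_add, one_mul]
  rw [d (fun t => t) (fun _ => 1) (fun t => hasDerivAt_id t)]
  have h2 : ∀ t : ℝ, HasDerivAt (fun t : ℝ => 1 + t * t) (2 * t) t := fun t =>
    (((hasDerivAt_id' t).fun_mul (hasDerivAt_id' t)).const_add 1).congr_deriv (by ring)
  rw [d (fun t => 1 + t * t) (fun t => 2 * t) h2]
  rw [d (fun t => 2 * t + (1 + t * t) * t) (fun t => 3 + 3 * t ^ 2) fun t =>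
    (((hasDerivAt_id' t).const_mul 2).fun_add ((h2 t).fun_mul (hasDerivAt_id' t))).congr_deriv
      (by ring)]
  simp

end Gaussian

section Moments

variable {N : ℕ}

lemma integrable_exp_dotp_sq {w : Fin N → ℝ} (hw : nrm w ≤ 1) :
    Integrable (fun a => Real.exp (dotp a w ^ 2 / 4)) (PR.stdGaussian N) := by
  refine integrable_comp_dotp w (f := fun x => Real.exp (x ^ 2 / 4)) (by fun_prop) ?_
  refine integrable_exp_sq_gaussianReal.mono' (by fun_prop) (Filter.Eventually.of_forall fun g => ?_)
  rw [Real.norm_eq_abs, Real.abs_exp, Real.exp_le_exp, mul_pow]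
  have := mul_le_of_le_one_left (sq_nonneg g) (pow_le_one₀ (nrm_nonneg w) hw (n := 2))
  linarith

lemma integral_exp_dotp_sq_le {w : Fin N → ℝ} (hw : nrm w ≤ 1) :
    ∫ a, Real.exp (dotp a w ^ 2 / 4) ∂(PR.stdGaussian N) ≤ 2 := by
  rw [integral_comp_dotp w (f := fun x => Real.exp (x ^ 2 / 4)) (by fun_prop)]
  refine (integral_mono_of_nonneg (Filter.Eventually.of_forall fun _ => (Real.exp_pos _).le)
    integrable_exp_sq_gaussianReal (Filter.Eventually.of_forall fun g => ?_)).trans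
    integral_exp_sq_gaussianReal_le
  simp only [Real.exp_le_exp, mul_pow]
  have := mul_le_of_le_one_left (sq_nonneg g) (pow_le_one₀ (nrm_nonneg w) hw (n := 2))
  linarith

lemma integrable_pow_four_gaussianReal :
    Integrable (fun x : ℝ => x ^ 4) (gaussianReal 0 1) := by
  refine (integrable_exp_sq_gaussianReal.const_mul 32).mono' (by fun_prop)
    (Filter.Eventually.of_forall fun g => ?_)
  have := Real.quadratic_le_exp_of_nonneg (x := g ^ 2 / 4) (by positivity)
  rw [Real.norm_eq_abs, abs_of_nonneg (by positivity)]
  nlinarith [sq_nonneg g]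

lemma integrable_dotp_pow_four (w : Fin N → ℝ) :
    Integrable (fun a => dotp a w ^ 4) (PR.stdGaussian N) := by
  refine integrable_comp_dotp w (f := fun x => x ^ 4) (by fun_prop) ?_
  simp_rw [mul_pow]
  exact integrable_pow_four_gaussianReal.const_mul _

lemma integral_dotp_pow_four (w : Fin N → ℝ) :
    ∫ a, dotp a w ^ 4 ∂(PR.stdGaussian N) = 3 * nrm w ^ 4 := by
  rw [integral_comp_dotp w (f := fun x => x ^ 4) (by fun_prop)]
  simp_rw [mul_pow]
  rw [integral_const_mul, integral_pow_four_gaussianReal, mul_comm]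

lemma dotp_sq_mul_dotp_sq (a z u : Fin N → ℝ) :
    dotp a z ^ 2 * dotp a u ^ 2 =
      (1 / 12) * (dotp a (z + u) ^ 4 + dotp a (z - u) ^ 4 - 2 * dotp a z ^ 4
        - 2 * dotp a u ^ 4) := by
  rw [dotp_add, dotp_sub]
  ring

lemma nrm_add_sq (z u : Fin N → ℝ) : nrm (z + u) ^ 2 = nrm z ^ 2 + nrm u ^ 2 + 2 * dotp z u := by
  simp only [nrm_sq, dotp, Finset.mul_sum, ← Finset.sum_add_distrib, Pi.add_apply]
  exact Finset.sum_congr rfl fun _ _ => by ring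

lemma nrm_sub_sq (z u : Fin N → ℝ) : nrm (z - u) ^ 2 = nrm z ^ 2 + nrm u ^ 2 - 2 * dotp z u := by
  simp only [nrm_sq, dotp, Finset.mul_sum, ← Finset.sum_add_distrib, ← Finset.sum_sub_distrib,
    Pi.sub_apply]
  exact Finset.sum_congr rfl fun _ _ => by ring

lemma integrable_dotp_sq_mul_dotp_sq (z u : Fin N → ℝ) :
    Integrable (fun a => dotp a z ^ 2 * dotp a u ^ 2) (PR.stdGaussian N) := by
  simp_rw [dotp_sq_mul_dotp_sq]
  exact ((((integrable_dotp_pow_four _).add (integrable_dotp_pow_four _)).sub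
    ((integrable_dotp_pow_four _).const_mul _)).sub
    ((integrable_dotp_pow_four _).const_mul _)).const_mul _

lemma integral_dotp_sq_mul_dotp_sq (z u : Fin N → ℝ) :
    ∫ a, dotp a z ^ 2 * dotp a u ^ 2 ∂(PR.stdGaussian N) = quarticMean z u := by
  simp_rw [dotp_sq_mul_dotp_sq]
  have h1 := integrable_dotp_pow_four (z + u)
  have h2 := integrable_dotp_pow_four (z - u)
  have h3 := (integrable_dotp_pow_four z).const_mul 2
  have h4 := (integrable_dotp_pow_four u).const_mul 2
  have h5 : Integrable (fun a => dotp a (z + u) ^ 4 + dotp a (z - u) ^ 4 - 2 * dotp a z ^ 4)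
      (PR.stdGaussian N) := (h1.add h2).sub h3
  rw [integral_const_mul, integral_sub h5 h4, integral_sub (h1.fun_add h2) h3,
    integral_add h1 h2, integral_const_mul, integral_const_mul]
  simp only [integral_dotp_pow_four]
  have e : ∀ x : ℝ, x ^ 4 = (x ^ 2) ^ 2 := fun x => by ring
  rw [e (nrm (z + u)), e (nrm (z - u)), nrm_add_sq, nrm_sub_sq, quarticMean]
  ring

/-- The square truncated at level `R²`. -/
def truncSq (R s : ℝ) : ℝ := min (s ^ 2) (R ^ 2)

lemma truncSq_nonneg (R s : ℝ) : 0 ≤ truncSq R s := le_min (sq_nonneg _) (sq_nonneg _)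

lemma truncSq_le (R s : ℝ) : truncSq R s ≤ s ^ 2 := min_le_left _ _

lemma truncSq_eq {R s : ℝ} (h : |s| ≤ R) : truncSq R s = s ^ 2 :=
  min_eq_left (sq_le_sq' (abs_le.1 h).1 (abs_le.1 h).2)

lemma measurable_truncSq (R : ℝ) : Measurable (truncSq R) := by
  unfold truncSq; fun_prop

lemma sq_mul_sq_sub_truncSq_le (R s w : ℝ) :
    s ^ 2 * w ^ 2 - truncSq R s * w ^ 2 ≤
      32 * Real.exp (-(R ^ 2 / 8)) * (Real.exp (s ^ 2 / 4) + Real.exp (w ^ 2 / 4)) := by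
  have h1 : s ^ 2 - truncSq R s ≤ 8 * (Real.exp (-(R ^ 2 / 8)) * Real.exp (s ^ 2 / 8)) := by
    rw [← Real.exp_add]
    have := Real.add_one_le_exp (-(R ^ 2 / 8) + s ^ 2 / 8)
    have := Real.exp_pos (-(R ^ 2 / 8) + s ^ 2 / 8)
    rcases le_total (s ^ 2) (R ^ 2) with h | h
    · rw [truncSq, min_eq_left h]; linarith
    · rw [truncSq, min_eq_right h]; linarith
  have h2 : w ^ 2 ≤ 8 * Real.exp (w ^ 2 / 8) := by
    have := Real.add_one_le_exp (w ^ 2 / 8)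
    linarith
  have e : ∀ x : ℝ, Real.exp (x / 4) = Real.exp (x / 8) ^ 2 := fun x => by
    rw [← Real.exp_nat_mul]; congr 1; push_cast; ring
  rw [e, e]
  calc s ^ 2 * w ^ 2 - truncSq R s * w ^ 2 = (s ^ 2 - truncSq R s) * w ^ 2 := by ring
    _ ≤ 8 * (Real.exp (-(R ^ 2 / 8)) * Real.exp (s ^ 2 / 8)) * (8 * Real.exp (w ^ 2 / 8)) :=
        mul_le_mul h1 h2 (sq_nonneg _) (by positivity)
    _ ≤ _ := by
        nlinarith [mul_nonneg (Real.exp_pos (-(R ^ 2 / 8))).le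
          (sq_nonneg (Real.exp (s ^ 2 / 8) - Real.exp (w ^ 2 / 8)))]

/-- Truncation changes the mean of the fourth-order form by an exponentially small amount. -/
lemma abs_integral_truncSq_sub_le (R : ℝ) {z u : Fin N → ℝ} (hz : nrm z ≤ 1) (hu : nrm u ≤ 1) :
    |∫ a, truncSq R (dotp a z) * dotp a u ^ 2 ∂(PR.stdGaussian N) - quarticMean z u| ≤
      128 * Real.exp (-(R ^ 2 / 8)) := by
  have hI := integrable_dotp_sq_mul_dotp_sq z u
  have hT : Integrable (fun a => truncSq R (dotp a z) * dotp a u ^ 2) (PR.stdGaussian N) := by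
    refine hI.mono' (((measurable_truncSq R).comp (measurable_dotp z)).mul
      ((measurable_dotp u).pow_const 2)).aestronglyMeasurable
      (Filter.Eventually.of_forall fun a => ?_)
    rw [Real.norm_eq_abs, abs_of_nonneg (mul_nonneg (truncSq_nonneg _ _) (sq_nonneg _))]
    exact mul_le_mul_of_nonneg_right (truncSq_le _ _) (sq_nonneg _)
  rw [← integral_dotp_sq_mul_dotp_sq, abs_sub_comm, ← integral_sub hI hT, abs_of_nonneg]
  · have h1 := integrable_exp_dotp_sq hz
    have h2 := integrable_exp_dotp_sq hu
    calc _ ≤ ∫ a, 32 * Real.exp (-(R ^ 2 / 8)) *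
          (Real.exp (dotp a z ^ 2 / 4) + Real.exp (dotp a u ^ 2 / 4)) ∂(PR.stdGaussian N) :=
          integral_mono (hI.sub hT) ((h1.fun_add h2).const_mul _)
            fun a => sq_mul_sq_sub_truncSq_le _ _ _
      _ ≤ 32 * Real.exp (-(R ^ 2 / 8)) * (2 + 2) := by
          rw [integral_const_mul, integral_add h1 h2]
          gcongr
          exacts [integral_exp_dotp_sq_le hz, integral_exp_dotp_sq_le hu]
      _ = _ := by ring
  · exact integral_nonneg fun a => sub_nonneg.2
      (mul_le_mul_of_nonneg_right (truncSq_le _ _) (sq_nonneg _))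

end Moments

section Bernstein

lemma exp_le_one_add_add_sq_mul_exp_abs (x : ℝ) :
    Real.exp x ≤ 1 + x + x ^ 2 * Real.exp |x| := by
  have h := Complex.norm_exp_sub_sum_le_norm_mul_exp (x : ℂ) 2
  have e : Complex.exp (x : ℂ) - ∑ k ∈ range 2, (x : ℂ) ^ k / (k.factorial : ℂ) =
      ((Real.exp x - 1 - x : ℝ) : ℂ) := by
    simp [Finset.sum_range_succ]
    ring
  rw [e, Complex.norm_real, Complex.norm_real, Real.norm_eq_abs, Real.norm_eq_abs, sq_abs] at h
  linarith [le_abs_self (Real.exp x - 1 - x)]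

variable {Ω : Type*} [MeasurableSpace Ω] {μ : Measure Ω} [IsProbabilityMeasure μ] {Y W : Ω → ℝ}

/-- Moment generating function bound for a nonnegative variable with an exponential moment. -/
lemma exp_moment_sub_mean (hY : Measurable Y) (hY0 : ∀ ω, 0 ≤ Y ω) (hYW : ∀ ω, Y ω ≤ W ω)
    (hint : Integrable (fun ω => Real.exp (W ω / 4)) μ) (hle : ∫ ω, Real.exp (W ω / 4) ∂μ ≤ 2)
    {l : ℝ} (hl : |l| ≤ 1 / 8) :
    Integrable (fun ω => Real.exp (l * (Y ω - ∫ x, Y x ∂μ))) μ ∧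
      ∫ ω, Real.exp (l * (Y ω - ∫ x, Y x ∂μ)) ∂μ ≤ Real.exp (2048 * l ^ 2) := by
  have hYle : ∀ ω, Y ω ≤ 4 * Real.exp (W ω / 4) := fun ω => by
    have := Real.add_one_le_exp (W ω / 4)
    linarith [hYW ω]
  have hYi : Integrable Y μ := (hint.const_mul 4).mono' hY.aestronglyMeasurable
    (Filter.Eventually.of_forall fun ω => by
      rw [Real.norm_eq_abs, abs_of_nonneg (hY0 ω)]; exact hYle ω)
  set M := ∫ x, Y x ∂μ with hM
  have hM0 : 0 ≤ M := integral_nonneg hY0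
  have hM8 : M ≤ 8 := by
    calc M ≤ ∫ ω, 4 * Real.exp (W ω / 4) ∂μ := integral_mono hYi (hint.const_mul 4) hYle
      _ ≤ 8 := by rw [integral_const_mul]; linarith
  have habs : ∀ ω, |Y ω - M| ≤ W ω + 8 := fun ω => by
    rw [abs_le]
    constructor <;> linarith [hY0 ω, hYW ω]
  have hx : ∀ ω, |l * (Y ω - M)| ≤ (W ω + 8) / 8 := fun ω => by
    rw [abs_mul]
    calc |l| * |Y ω - M| ≤ 1 / 8 * (W ω + 8) :=
          mul_le_mul hl (habs ω) (abs_nonneg _) (by norm_num)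
      _ = _ := by ring
  have hE2 : Real.exp 2 ≤ 8 := by
    have h := Real.exp_one_lt_d9
    have : Real.exp 2 = Real.exp 1 ^ 2 := by rw [← Real.exp_nat_mul]; norm_num
    rw [this]
    nlinarith [Real.exp_pos 1]
  have hquad : ∀ ω, (l * (Y ω - M)) ^ 2 * Real.exp |l * (Y ω - M)| ≤
      1024 * l ^ 2 * Real.exp (W ω / 4) := fun ω => by
    have hW0 : 0 ≤ W ω := (hY0 ω).trans (hYW ω)
    have h1 : (Y ω - M) ^ 2 ≤ (W ω + 8) ^ 2 := by
      rw [← sq_abs]; gcongr; exact habs ω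
    have h2 := Real.quadratic_le_exp_of_nonneg (x := (W ω + 8) / 8) (by positivity)
    have h3 : (W ω + 8) ^ 2 ≤ 128 * Real.exp ((W ω + 8) / 8) := by nlinarith
    have h4 : Real.exp |l * (Y ω - M)| ≤ Real.exp ((W ω + 8) / 8) := Real.exp_le_exp.2 (hx ω)
    have h5 : Real.exp ((W ω + 8) / 8) * Real.exp ((W ω + 8) / 8) =
        Real.exp 2 * Real.exp (W ω / 4) := by
      rw [← Real.exp_add, ← Real.exp_add]; congr 1; ring
    calc (l * (Y ω - M)) ^ 2 * Real.exp |l * (Y ω - M)|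
        ≤ (l ^ 2 * (128 * Real.exp ((W ω + 8) / 8))) * Real.exp ((W ω + 8) / 8) := by
          rw [mul_pow]
          exact mul_le_mul (mul_le_mul_of_nonneg_left (h1.trans h3) (sq_nonneg _)) h4
            (Real.exp_pos _).le (by positivity)
      _ = 128 * l ^ 2 * (Real.exp 2 * Real.exp (W ω / 4)) := by rw [← h5]; ring
      _ ≤ 128 * l ^ 2 * (8 * Real.exp (W ω / 4)) := by gcongr
      _ = _ := by ring
  have hb : ∀ ω, Real.exp (l * (Y ω - M)) ≤
      1 + l * (Y ω - M) + 1024 * l ^ 2 * Real.exp (W ω / 4) := fun ω =>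
    (exp_le_one_add_add_sq_mul_exp_abs _).trans (by linarith [hquad ω])
  have hi0 : Integrable (fun ω => Y ω - M) μ := hYi.sub (integrable_const M)
  have hi1 : Integrable (fun ω => 1 + l * (Y ω - M)) μ :=
    (integrable_const 1).add (hi0.const_mul l)
  have hi2 : Integrable (fun ω => 1024 * l ^ 2 * Real.exp (W ω / 4)) μ := hint.const_mul _
  have hi : Integrable (fun ω => Real.exp (l * (Y ω - M))) μ :=
    (hi1.add hi2).mono' (by fun_prop) (Filter.Eventually.of_forall fun ω => by
      rw [Real.norm_eq_abs, Real.abs_exp]; exact hb ω)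
  refine ⟨hi, ?_⟩
  calc ∫ ω, Real.exp (l * (Y ω - M)) ∂μ
      ≤ ∫ ω, (1 + l * (Y ω - M) + 1024 * l ^ 2 * Real.exp (W ω / 4)) ∂μ :=
        integral_mono hi (hi1.add hi2) hb
    _ = 1 + 1024 * l ^ 2 * ∫ ω, Real.exp (W ω / 4) ∂μ := by
        rw [integral_add hi1 hi2, integral_add (integrable_const 1)
          (hi0.const_mul l), integral_const_mul, integral_const_mul,
          integral_sub hYi (integrable_const M)]
        simp [← hM]
    _ ≤ 2048 * l ^ 2 + 1 := by nlinarith [sq_nonneg l]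
    _ ≤ _ := Real.add_one_le_exp _

/-- Two-sided Chernoff bound for sums of i.i.d. copies of a nonnegative variable with an
exponential moment. -/
lemma measureReal_abs_sum_sub_mean_ge_le (hY : Measurable Y) (hY0 : ∀ ω, 0 ≤ Y ω)
    (hYW : ∀ ω, Y ω ≤ W ω) (hint : Integrable (fun ω => Real.exp (W ω / 4)) μ)
    (hle : ∫ ω, Real.exp (W ω / 4) ∂μ ≤ 2) (m : ℕ) {l : ℝ} (hl0 : 0 ≤ l) (hl : l ≤ 1 / 8)
    (s : ℝ) :
    (Measure.pi fun _ : Fin m => μ).real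
      {a | m * s ≤ |∑ i, (Y (a i) - ∫ x, Y x ∂μ)|} ≤
      2 * Real.exp (m * (2048 * l ^ 2 - l * s)) := by
  have one : ∀ r : ℝ, |r| = 1 → (Measure.pi fun _ : Fin m => μ).real
      {a | m * s ≤ r * ∑ i, (Y (a i) - ∫ x, Y x ∂μ)} ≤
      Real.exp (m * (2048 * l ^ 2 - l * s)) := by
    intro r hr
    have hr2 : (l * r) ^ 2 = l ^ 2 := by rw [mul_pow, ← sq_abs r, hr]; ring
    obtain ⟨hi, hb⟩ := exp_moment_sub_mean (l := l * r) hY hY0 hYW hint hle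
      (by rw [abs_mul, hr, mul_one, abs_of_nonneg hl0]; exact hl)
    have e : ∀ a : Fin m → Ω, Real.exp (l * (r * ∑ i, (Y (a i) - ∫ x, Y x ∂μ))) =
        ∏ i, Real.exp (l * r * (Y (a i) - ∫ x, Y x ∂μ)) := fun a => by
      rw [← Real.exp_sum, ← mul_assoc, Finset.mul_sum]
    refine (measure_ge_le_exp_mul_mgf _ hl0 ?_).trans ?_
    · simp_rw [e]
      exact Integrable.fintype_prod (f := fun _ : Fin m => fun x =>
        Real.exp (l * r * (Y x - ∫ x, Y x ∂μ))) fun _ => hi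
    · rw [mgf]
      simp_rw [e]
      rw [integral_fintype_prod_eq_pow (f := fun x => Real.exp (l * r * (Y x - ∫ x, Y x ∂μ))),
        Fintype.card_fin]
      calc _ ≤ Real.exp (-l * (m * s)) * Real.exp (2048 * (l * r) ^ 2) ^ m := by
            gcongr
        _ = _ := by
            rw [← Real.exp_nat_mul, ← Real.exp_add, hr2]
            congr 1
            ring
  have hsub : {a : Fin m → Ω | m * s ≤ |∑ i, (Y (a i) - ∫ x, Y x ∂μ)|} ⊆
      {a | m * s ≤ 1 * ∑ i, (Y (a i) - ∫ x, Y x ∂μ)} ∪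
      {a | m * s ≤ -1 * ∑ i, (Y (a i) - ∫ x, Y x ∂μ)} := by
    intro a ha
    rcases le_abs'.1 (le_refl |∑ i, (Y (a i) - ∫ x, Y x ∂μ)|) with h | h
    · right
      simp only [Set.mem_ofPred_eq] at ha ⊢
      linarith
    · left
      simp only [Set.mem_ofPred_eq] at ha ⊢
      linarith
  calc _ ≤ _ := measureReal_mono hsub
    _ ≤ _ := measureReal_union_le _ _
    _ ≤ Real.exp (m * (2048 * l ^ 2 - l * s)) + Real.exp (m * (2048 * l ^ 2 - l * s)) :=
        add_le_add (one 1 (by simp)) (one (-1) (by simp))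
    _ = _ := by ring

end Bernstein

section Net

variable {N : ℕ}

lemma abs_apply_le_one {z : Fin N → ℝ} (hz : nrm z ≤ 1) (j : Fin N) : |z j| ≤ 1 := by
  rw [← sq_le_one_iff_abs_le_one]
  calc z j ^ 2 ≤ ∑ k, z k ^ 2 :=
        Finset.single_le_sum (f := fun k => z k ^ 2) (fun _ _ => sq_nonneg _) (Finset.mem_univ j)
    _ = nrm z ^ 2 := (nrm_sq z).symm
    _ ≤ 1 := pow_le_one₀ (nrm_nonneg z) hz

lemma exists_int_div_near {M : ℕ} (hM : 0 < M) {x : ℝ} (hx : |x| ≤ 1) :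
    ∃ c ∈ Finset.Icc (-(M : ℤ)) M, |(c : ℝ) / M| ≤ |x| ∧ |x - c / M| ≤ 1 / M := by
  have hM' : (0 : ℝ) < M := by exact_mod_cast hM
  have pos : ∀ y : ℝ, 0 ≤ y → y ≤ 1 →
      ∃ c ∈ Finset.Icc (-(M : ℤ)) M, |(c : ℝ) / M| ≤ y ∧ |y - c / M| ≤ 1 / M := by
    intro y hy0 hy1
    have h0 : (0 : ℤ) ≤ ⌊M * y⌋ := Int.floor_nonneg.2 (by positivity)
    have h0' : (0 : ℝ) ≤ (⌊M * y⌋ : ℝ) := by exact_mod_cast h0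
    have h1 := Int.floor_le (M * y)
    have h2 := Int.lt_floor_add_one (M * y)
    refine ⟨⌊M * y⌋, Finset.mem_Icc.2 ⟨by omega, ?_⟩, ?_, ?_⟩
    · have : (⌊M * y⌋ : ℝ) ≤ M := h1.trans (mul_le_of_le_one_right hM'.le hy1)
      exact_mod_cast this
    · rw [abs_of_nonneg (by positivity), div_le_iff₀ hM']
      linarith
    · have e : y - (⌊M * y⌋ : ℝ) / M = (M * y - ⌊M * y⌋) / M := by field_simp
      rw [e, abs_of_nonneg (div_nonneg (by linarith) hM'.le)]
      gcongr
      linarith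
  rcases le_total 0 x with h | h
  · rw [abs_of_nonneg h] at hx ⊢
    exact pos x h hx
  · rw [abs_of_nonpos h] at hx ⊢
    obtain ⟨c, hc, h1, h2⟩ := pos (-x) (by linarith) hx
    rw [Finset.mem_Icc] at hc
    refine ⟨-c, Finset.mem_Icc.2 ⟨by omega, by omega⟩, ?_, ?_⟩
    · rwa [Int.cast_neg, neg_div, abs_neg]
    · rw [← abs_neg]
      convert h2 using 2
      push_cast
      ring

/-- A coordinatewise `1/M`-net of the unit ball inside the unit ball. -/
lemma exists_net (N : ℕ) {M : ℕ} (hM : 0 < M) :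
    ∃ S : Finset (Fin N → ℝ), S.card ≤ (2 * M + 1) ^ N ∧ (∀ z ∈ S, nrm z ≤ 1) ∧
      ∀ z, nrm z ≤ 1 → ∃ z' ∈ S, ∀ j, |z j - z' j| ≤ 1 / M := by
  classical
  let G : Finset (Fin N → ℤ) := Fintype.piFinset fun _ => Finset.Icc (-(M : ℤ)) M
  let p : (Fin N → ℤ) → Fin N → ℝ := fun k j => (k j : ℝ) / M
  refine ⟨(G.image p).filter fun z => nrm z ≤ 1, ?_, fun z hz => (Finset.mem_filter.1 hz).2, ?_⟩
  · refine (Finset.card_filter_le _ _).trans (Finset.card_image_le.trans ?_)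
    rw [Fintype.card_piFinset_const, Int.card_Icc]
    gcongr
    omega
  · intro z hz
    choose c hc h1 h2 using fun j => exists_int_div_near hM (abs_apply_le_one hz j)
    refine ⟨p c, Finset.mem_filter.2 ⟨Finset.mem_image_of_mem _ (Fintype.mem_piFinset.2 hc), ?_⟩, h2⟩
    refine le_trans (Real.sqrt_le_sqrt (Finset.sum_le_sum fun j _ => ?_)) hz
    exact sq_le_sq.2 (h1 j)

lemma abs_dotp_le {a v : Fin N → ℝ} {b ε : ℝ} (hb : 0 ≤ b) (ha : ∀ j, |a j| ≤ b)
    (hv : ∀ j, |v j| ≤ ε) : |dotp a v| ≤ N * b * ε := by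
  calc |dotp a v| ≤ ∑ j, |a j * v j| := Finset.abs_sum_le_sum_abs _ _
    _ ≤ ∑ _j : Fin N, b * ε := Finset.sum_le_sum fun j _ => by
        rw [abs_mul]; exact mul_le_mul (ha j) (hv j) (abs_nonneg _) hb
    _ = _ := by simp [mul_assoc]

lemma abs_mul_sub_mul_le {x x' y y' b c d e : ℝ} (hc : 0 ≤ c) (hx : |x - x'| ≤ c) (hy : |y| ≤ b)
    (hx' : |x'| ≤ d) (hy' : |y - y'| ≤ e) : |x * y - x' * y'| ≤ c * b + d * e := by
  have : x * y - x' * y' = (x - x') * y + x' * (y - y') := by ring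
  rw [this]
  refine (abs_add_le _ _).trans (add_le_add ?_ ?_)
  · rw [abs_mul]; exact mul_le_mul hx hy (abs_nonneg _) hc
  · rw [abs_mul]; exact mul_le_mul hx' hy' (abs_nonneg _) ((abs_nonneg _).trans hx')

lemma abs_sq_sub_sq_le {x y b e : ℝ} (he : 0 ≤ e) (hx : |x| ≤ b) (hy : |y| ≤ b)
    (h : |x - y| ≤ e) : |x ^ 2 - y ^ 2| ≤ 2 * b * e := by
  have := abs_mul_sub_mul_le he h hx hy h
  rw [sq, sq]
  linarith

lemma abs_truncSq_mul_sub_le {R s s' w w' B ε : ℝ} (hε : 0 ≤ ε) (hs : |s| ≤ B) (hs' : |s'| ≤ B)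
    (hw : |w| ≤ B) (hw' : |w'| ≤ B) (h1 : |s - s'| ≤ B * ε) (h2 : |w - w'| ≤ B * ε) :
    |truncSq R s * w ^ 2 - truncSq R s' * w' ^ 2| ≤ 4 * B ^ 4 * ε := by
  have hB : 0 ≤ B := (abs_nonneg _).trans hs
  have t1 : |truncSq R s - truncSq R s'| ≤ 2 * B * (B * ε) :=
    (abs_inf_sub_inf_le_abs (s ^ 2) (s' ^ 2) (R ^ 2)).trans
      (abs_sq_sub_sq_le (by positivity) hs hs' h1)
  have t2 : |w ^ 2 - w' ^ 2| ≤ 2 * B * (B * ε) := abs_sq_sub_sq_le (by positivity) hw hw' h2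
  have t3 : |truncSq R s'| ≤ B ^ 2 := by
    rw [abs_of_nonneg (truncSq_nonneg _ _)]
    exact (truncSq_le _ _).trans (sq_le_sq' (by linarith [(abs_le.1 hs').1]) (abs_le.1 hs').2)
  have t4 : |w ^ 2| ≤ B ^ 2 := by
    rw [abs_of_nonneg (sq_nonneg _)]
    exact sq_le_sq' (by linarith [(abs_le.1 hw).1]) (abs_le.1 hw).2
  refine (abs_mul_sub_mul_le (by positivity) t1 t4 t3 t2).trans_eq ?_
  ring

lemma abs_dotp_sub_dotp_le {z u z' u' : Fin N → ℝ} {ε : ℝ} (hε : 0 ≤ ε) (hu : nrm u ≤ 1)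
    (hz' : nrm z' ≤ 1) (h1 : ∀ j, |z j - z' j| ≤ ε) (h2 : ∀ j, |u j - u' j| ≤ ε) :
    |dotp z u - dotp z' u'| ≤ 2 * N * ε := by
  rw [dotp, dotp, ← Finset.sum_sub_distrib]
  calc _ ≤ ∑ j, |z j * u j - z' j * u' j| := Finset.abs_sum_le_sum_abs _ _
    _ ≤ ∑ _j : Fin N, (ε * 1 + 1 * ε) := Finset.sum_le_sum fun j _ =>
        abs_mul_sub_mul_le hε (h1 j) (abs_apply_le_one hu j) (abs_apply_le_one hz' j) (h2 j)
    _ = _ := by simp; ring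

lemma abs_dotp_le_one {z u : Fin N → ℝ} (hz : nrm z ≤ 1) (hu : nrm u ≤ 1) : |dotp z u| ≤ 1 := by
  rw [← sq_le_one_iff_abs_le_one]
  exact (dotp_sq_le z u).trans (mul_le_one₀ (pow_le_one₀ (nrm_nonneg z) hz) (sq_nonneg _)
    (pow_le_one₀ (nrm_nonneg u) hu))

lemma abs_quarticMean_sub_le {z u z' u' : Fin N → ℝ} {ε : ℝ} (hε : 0 ≤ ε) (hz : nrm z ≤ 1)
    (hu : nrm u ≤ 1) (hz' : nrm z' ≤ 1) (hu' : nrm u' ≤ 1) (h1 : ∀ j, |z j - z' j| ≤ ε)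
    (h2 : ∀ j, |u j - u' j| ≤ ε) :
    |quarticMean z u - quarticMean z' u'| ≤ 12 * N * ε := by
  have hc : 0 ≤ 2 * N * ε := by positivity
  have t1 := abs_mul_sub_mul_le hc (abs_dotp_sub_dotp_le hε hz hz' h1 h1) (abs_dotp_le_one hu hu)
    (abs_dotp_le_one hz' hz') (abs_dotp_sub_dotp_le hε hu hu' h2 h2)
  have t2 := abs_sq_sub_sq_le hc (abs_dotp_le_one hz hu) (abs_dotp_le_one hz' hu')
    (abs_dotp_sub_dotp_le hε hu hz' h1 h2)
  simp only [dotp_self] at t1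
  simp only [quarticMean]
  rw [abs_le] at t1 t2 ⊢
  constructor <;> linarith

/-- The empirical fourth-order form with the first factor truncated at level `R²`. -/
def truncQuartic {m : ℕ} (R : ℝ) (a : Fin m → Fin N → ℝ) (z u : Fin N → ℝ) : ℝ :=
  (m : ℝ)⁻¹ * ∑ i, truncSq R (dotp (a i) z) * dotp (a i) u ^ 2

lemma truncQuartic_eq_quartic {m : ℕ} {R : ℝ} {a : Fin m → Fin N → ℝ} {z : Fin N → ℝ}
    (hz : ∀ i, |dotp (a i) z| ≤ R) (u : Fin N → ℝ) : truncQuartic R a z u = quartic a z u := by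
  simp only [truncQuartic, quartic, truncSq_eq (hz _)]

lemma abs_truncQuartic_sub_le {m : ℕ} (R : ℝ) {a : Fin m → Fin N → ℝ} {z u z' u' : Fin N → ℝ}
    {b ε : ℝ} (hb : 0 ≤ b) (hε : 0 ≤ ε) (ha : ∀ i j, |a i j| ≤ b) (hz : nrm z ≤ 1)
    (hu : nrm u ≤ 1) (hz' : nrm z' ≤ 1) (hu' : nrm u' ≤ 1) (h1 : ∀ j, |z j - z' j| ≤ ε)
    (h2 : ∀ j, |u j - u' j| ≤ ε) :
    |truncQuartic R a z u - truncQuartic R a z' u'| ≤ 4 * (N * b) ^ 4 * ε := by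
  have bd : ∀ v : Fin N → ℝ, nrm v ≤ 1 → ∀ i, |dotp (a i) v| ≤ N * b := fun v hv i => by
    simpa using abs_dotp_le hb (ha i) (abs_apply_le_one hv)
  have bd' : ∀ v v' : Fin N → ℝ, (∀ j, |v j - v' j| ≤ ε) → ∀ i,
      |dotp (a i) v - dotp (a i) v'| ≤ N * b * ε := fun v v' h i => by
    rw [← dotp_sub]
    exact abs_dotp_le hb (ha i) h
  rw [truncQuartic, truncQuartic, ← mul_sub, ← Finset.sum_sub_distrib, abs_mul,
    abs_of_nonneg (by positivity)]
  calc _ ≤ (m : ℝ)⁻¹ * ∑ _i : Fin m, 4 * (N * b) ^ 4 * ε := by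
        gcongr
        refine (Finset.abs_sum_le_sum_abs _ _).trans (Finset.sum_le_sum fun i _ => ?_)
        exact abs_truncSq_mul_sub_le hε (bd z hz i) (bd z' hz' i) (bd u hu i) (bd u' hu' i)
          (bd' z z' h1 i) (bd' u u' h2 i)
    _ = ((m : ℝ)⁻¹ * m) * (4 * (N * b) ^ 4 * ε) := by simp; ring
    _ ≤ _ := mul_le_of_le_one_left (by positivity) inv_mul_le_one

/-- A deviation bound on the net extends to all incoherent vectors in the unit ball. -/
lemma abs_quartic_sub_quarticMean_le {m : ℕ} {R : ℝ} {a : Fin m → Fin N → ℝ}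
    {S : Finset (Fin N → ℝ)} {b ε t : ℝ} (hb : 0 ≤ b) (hε : 0 ≤ ε) (ha : ∀ i j, |a i j| ≤ b)
    (hS : ∀ z ∈ S, nrm z ≤ 1) (hnet : ∀ z, nrm z ≤ 1 → ∃ z' ∈ S, ∀ j, |z j - z' j| ≤ ε)
    (hdev : ∀ z ∈ S, ∀ u ∈ S, |truncQuartic R a z u -
      ∫ x, truncSq R (dotp x z) * dotp x u ^ 2 ∂(PR.stdGaussian N)| ≤ t)
    {z u : Fin N → ℝ} (hz : nrm z ≤ 1) (hu : nrm u ≤ 1) (hinc : ∀ i, |dotp (a i) z| ≤ R) :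
    |quartic a z u - quarticMean z u| ≤
      4 * (N * b) ^ 4 * ε + t + 128 * Real.exp (-(R ^ 2 / 8)) + 12 * N * ε := by
  obtain ⟨z', hz'S, h1⟩ := hnet z hz
  obtain ⟨u', hu'S, h2⟩ := hnet u hu
  have hz' := hS z' hz'S
  have hu' := hS u' hu'S
  have t1 := abs_truncQuartic_sub_le R hb hε ha hz hu hz' hu' h1 h2
  have t2 := abs_quarticMean_sub_le hε hz hu hz' hu' h1 h2
  have t3 := hdev z' hz'S u' hu'S
  have t4 := abs_integral_truncSq_sub_le R hz' hu'
  rw [truncQuartic_eq_quartic hinc] at t1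
  rw [abs_le] at t1 t2 t3 t4 ⊢
  constructor <;> linarith

end Net

section Tail

variable {N : ℕ}

lemma design_real_abs_dotp_ge_le {m : ℕ} {w : Fin N → ℝ} (hw : nrm w ≤ 1) {t : ℝ} (ht : 0 ≤ t)
    (i : Fin m) :
    (design m N).real {a | t ≤ |dotp (a i) w|} ≤ 2 * Real.exp (-(t ^ 2 / 4)) := by
  have hmeas : MeasurableSet {x : Fin N → ℝ | t ≤ |dotp x w|} :=
    measurableSet_le measurable_const (measurable_dotp w).abs
  have e : (design m N).real {a | t ≤ |dotp (a i) w|} =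
      (PR.stdGaussian N).real {x | t ≤ |dotp x w|} :=
    (measurePreserving_eval (fun _ : Fin m => PR.stdGaussian N) i).measureReal_preimage
      hmeas.nullMeasurableSet
  have h := mul_meas_ge_le_integral_of_nonneg (μ := PR.stdGaussian N)
    (Filter.Eventually.of_forall fun a => (Real.exp_pos (dotp a w ^ 2 / 4)).le)
    (integrable_exp_dotp_sq hw) (Real.exp (t ^ 2 / 4))
  have hs : {x : Fin N → ℝ | t ≤ |dotp x w|} ⊆
      {x | Real.exp (t ^ 2 / 4) ≤ Real.exp (dotp x w ^ 2 / 4)} := fun x hx => by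
    have : t ^ 2 ≤ dotp x w ^ 2 := by
      rw [← sq_abs (dotp x w)]
      exact pow_le_pow_left₀ ht hx 2
    exact Real.exp_le_exp.2 (by linarith)
  rw [e, Real.exp_neg, ← div_eq_mul_inv, le_div_iff₀' (Real.exp_pos _)]
  exact (mul_le_mul_of_nonneg_left (measureReal_mono hs) (Real.exp_pos _).le).trans
    (h.trans (integral_exp_dotp_sq_le hw))

lemma design_real_abs_truncQuartic_sub_ge_le {m : ℕ} (hm : 0 < m) {R : ℝ} (hR : 0 < R)
    {z u : Fin N → ℝ} (hu : nrm u ≤ 1) {l : ℝ} (hl0 : 0 ≤ l) (hl : l ≤ 1 / 8) (s : ℝ) :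
    (design m N).real {a | R ^ 2 * s ≤ |truncQuartic R a z u -
      ∫ x, truncSq R (dotp x z) * dotp x u ^ 2 ∂(PR.stdGaussian N)|} ≤
      2 * Real.exp (m * (2048 * l ^ 2 - l * s)) := by
  have hm' : (0 : ℝ) < m := by exact_mod_cast hm
  let Y : (Fin N → ℝ) → ℝ := fun x => (R ^ 2)⁻¹ * (truncSq R (dotp x z) * dotp x u ^ 2)
  have hY : Measurable Y := (((measurable_truncSq R).comp (measurable_dotp z)).mul
    ((measurable_dotp u).pow_const 2)).const_mul _
  have hY0 : ∀ x, 0 ≤ Y x := fun x =>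
    mul_nonneg (by positivity) (mul_nonneg (truncSq_nonneg _ _) (sq_nonneg _))
  have hYW : ∀ x, Y x ≤ dotp x u ^ 2 := fun x => by
    rw [inv_mul_le_iff₀ (by positivity)]
    exact mul_le_mul_of_nonneg_right (min_le_right _ _) (sq_nonneg _)
  have h := measureReal_abs_sum_sub_mean_ge_le (μ := PR.stdGaussian N) hY hY0 hYW
    (integrable_exp_dotp_sq hu) (integral_exp_dotp_sq_le hu) m hl0 hl s
  refine (measureReal_mono fun a ha => ?_).trans h
  have e : ∑ i, (Y (a i) - ∫ x, Y x ∂(PR.stdGaussian N)) = m * (R ^ 2)⁻¹ * (truncQuartic R a z u -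
      ∫ x, truncSq R (dotp x z) * dotp x u ^ 2 ∂(PR.stdGaussian N)) := by
    simp only [Y, integral_const_mul, truncQuartic, Finset.sum_sub_distrib, ← Finset.mul_sum,
      Finset.sum_const, Finset.card_univ, Fintype.card_fin, nsmul_eq_mul]
    field_simp
  simp only [Set.mem_ofPred_eq] at ha ⊢
  rw [e, abs_mul, abs_of_pos (by positivity), mul_assoc]
  gcongr
  rwa [le_inv_mul_iff₀ (by positivity)]

end Tail

section Main

variable {N : ℕ}

lemma dotp_single (a : Fin N → ℝ) (j : Fin N) : dotp a (Pi.single j 1) = a j := by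
  simp [dotp, Pi.single_apply]

lemma nrm_single (j : Fin N) : nrm (Pi.single j 1 : Fin N → ℝ) = 1 := by
  simp [nrm, Pi.single_apply]

/-- With high probability all design entries, and all products with a fixed unit vector, are at
most `8 √(log m)`. -/
lemma design_real_exists_large_le {m : ℕ} (hm : 1 ≤ Real.log m) (hN : 1 ≤ N) (hNm : N ≤ m)
    {xs : Fin N → ℝ} (hxs : nrm xs = 1) :
    (design m N).real {a | ∃ i, (∃ j, 8 * √(Real.log m) ≤ |a i j|) ∨
      8 * √(Real.log m) ≤ |dotp (a i) xs|} ≤ 4 * Real.exp (-(14 * Real.log m)) := by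
  have hm0 : (0 : ℝ) < m := by
    rcases Nat.eq_zero_or_pos m with h | h
    · subst h; simp at hm; linarith
    · exact_mod_cast h
  set t := 8 * √(Real.log m) with ht
  have ht0 : 0 ≤ t := by positivity
  have htsq : t ^ 2 / 4 = 16 * Real.log m := by
    rw [ht, mul_pow, Real.sq_sqrt (by linarith)]; ring
  have hsub : {a : Fin m → Fin N → ℝ | ∃ i, (∃ j, t ≤ |a i j|) ∨ t ≤ |dotp (a i) xs|} ⊆
      ⋃ i, ((⋃ j, {a | t ≤ |dotp (a i) (Pi.single j 1)|}) ∪ {a | t ≤ |dotp (a i) xs|}) := by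
    rintro a ⟨i, ⟨j, h⟩ | h⟩
    · exact Set.mem_iUnion.2 ⟨i, Or.inl (Set.mem_iUnion.2 ⟨j, by simpa [dotp_single] using h⟩)⟩
    · exact Set.mem_iUnion.2 ⟨i, Or.inr h⟩
  have hE : Real.exp (-(t ^ 2 / 4)) = (m : ℝ)⁻¹ * (m : ℝ)⁻¹ * Real.exp (-(14 * Real.log m)) := by
    rw [← Real.exp_log hm0, ← Real.exp_neg, ← Real.exp_add, ← Real.exp_add, htsq, Real.log_exp]
    congr 1
    ring
  have hNm' : (N : ℝ) ≤ m := by exact_mod_cast hNm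
  have h1m : (1 : ℝ) ≤ m := le_trans (by exact_mod_cast hN) hNm'
  calc _ ≤ _ := measureReal_mono hsub
    _ ≤ ∑ i : Fin m, (design m N).real
        ((⋃ j, {a | t ≤ |dotp (a i) (Pi.single j 1)|}) ∪ {a | t ≤ |dotp (a i) xs|}) :=
        measureReal_iUnion_fintype_le _
    _ ≤ ∑ _i : Fin m, (∑ _j : Fin N, 2 * Real.exp (-(t ^ 2 / 4)) + 2 * Real.exp (-(t ^ 2 / 4))) := by
        refine Finset.sum_le_sum fun i _ => (measureReal_union_le _ _).trans (add_le_add ?_ ?_)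
        · exact (measureReal_iUnion_fintype_le _).trans (Finset.sum_le_sum fun j _ =>
            design_real_abs_dotp_ge_le (nrm_single j).le ht0 i)
        · exact design_real_abs_dotp_ge_le hxs.le ht0 i
    _ = 2 * ((m : ℝ) * (m : ℝ)⁻¹) * ((N + 1) * (m : ℝ)⁻¹) * Real.exp (-(14 * Real.log m)) := by
        simp only [Finset.sum_const, Finset.card_univ, Fintype.card_fin, nsmul_eq_mul, hE]
        ring
    _ ≤ 2 * 1 * 2 * Real.exp (-(14 * Real.log m)) := by
        gcongr
        · exact mul_inv_le_one
        · rw [← div_eq_mul_inv, div_le_iff₀ hm0]; linarith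
    _ = _ := by ring

/-- Uniform concentration of the truncated fourth-order form over a net. -/
lemma design_real_exists_net_dev_le {m : ℕ} (hm : 3 ≤ m) (hL : 1 ≤ Real.log m) (hN : 1 ≤ N)
    (hsample : 64 * N * Real.log m ≤ m) {R : ℝ} (hR : 0 < R) {S : Finset (Fin N → ℝ)}
    (hcard : S.card ≤ (2 * m ^ 9 + 1) ^ N) (hS : ∀ z ∈ S, nrm z ≤ 1) :
    (design m N).real {a | ∃ z ∈ S, ∃ u ∈ S, R ^ 2 * (2082 * √(N * Real.log m / m)) ≤
      |truncQuartic R a z u - ∫ x, truncSq R (dotp x z) * dotp x u ^ 2 ∂(PR.stdGaussian N)|} ≤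
      2 * Real.exp (-(14 * Real.log m)) := by
  have hm0 : (0 : ℝ) < m := by exact_mod_cast (by omega : 0 < m)
  have hN' : (1 : ℝ) ≤ N := by exact_mod_cast hN
  set L := Real.log m with hLdef
  set l := √(N * L / m) with hl
  have hl0 : 0 ≤ l := Real.sqrt_nonneg _
  have hlsq : m * l ^ 2 = N * L := by
    rw [hl, Real.sq_sqrt (by positivity)]; field_simp
  have hl8 : l ≤ 1 / 8 := by
    refine Real.sqrt_le_iff.2 ⟨by norm_num, ?_⟩
    rw [div_le_iff₀ hm0]
    linarith
  have hsub : {a : Fin m → Fin N → ℝ | ∃ z ∈ S, ∃ u ∈ S, R ^ 2 * (2082 * l) ≤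
      |truncQuartic R a z u - ∫ x, truncSq R (dotp x z) * dotp x u ^ 2 ∂(PR.stdGaussian N)|} ⊆
      ⋃ p ∈ S ×ˢ S, {a | R ^ 2 * (2082 * l) ≤ |truncQuartic R a p.1 p.2 -
        ∫ x, truncSq R (dotp x p.1) * dotp x p.2 ^ 2 ∂(PR.stdGaussian N)|} := by
    rintro a ⟨z, hz, u, hu, h⟩
    exact Set.mem_biUnion (x := (z, u)) (Finset.mem_coe.2 (Finset.mk_mem_product hz hu)) h
  have hexp : (m : ℝ) * (2048 * l ^ 2 - l * (2082 * l)) = -(34 * (N * L)) := by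
    rw [← hlsq]; ring
  have hbase : (2 * (m : ℝ) ^ 9 + 1) ≤ Real.exp (10 * L) := by
    have h3 : (3 : ℝ) ≤ m := by exact_mod_cast hm
    have e : Real.exp (10 * L) = (m : ℝ) ^ 10 := by
      rw [hLdef, mul_comm, Real.exp_mul, Real.exp_log hm0]; norm_cast
    have h9 : (1 : ℝ) ≤ (m : ℝ) ^ 9 := one_le_pow₀ (by linarith)
    rw [e, pow_succ]
    nlinarith
  have hcard' : (S.card : ℝ) ≤ Real.exp (10 * (N * L)) := by
    calc (S.card : ℝ) ≤ (2 * (m : ℝ) ^ 9 + 1) ^ N := by exact_mod_cast hcard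
      _ ≤ Real.exp (10 * L) ^ N := by gcongr
      _ = _ := by rw [← Real.exp_nat_mul]; congr 1; ring
  calc _ ≤ _ := measureReal_mono hsub (measure_ne_top _ _)
    _ ≤ ∑ p ∈ S ×ˢ S, (design m N).real {a | R ^ 2 * (2082 * l) ≤ |truncQuartic R a p.1 p.2 -
        ∫ x, truncSq R (dotp x p.1) * dotp x p.2 ^ 2 ∂(PR.stdGaussian N)|} :=
        measureReal_biUnion_finset_le _ _
    _ ≤ ∑ _p ∈ S ×ˢ S, 2 * Real.exp (-(34 * (N * L))) := by
        refine Finset.sum_le_sum fun p hp => ?_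
        rw [← hexp]
        exact design_real_abs_truncQuartic_sub_ge_le (by omega) hR
          (hS _ (Finset.mem_product.1 hp).2) hl0 hl8 _
    _ = S.card * S.card * (2 * Real.exp (-(34 * (N * L)))) := by
        rw [Finset.sum_const, Finset.card_product, nsmul_eq_mul]; push_cast; ring
    _ ≤ Real.exp (10 * (N * L)) * Real.exp (10 * (N * L)) * (2 * Real.exp (-(34 * (N * L)))) := by
        gcongr
    _ = 2 * Real.exp (-(14 * (N * L))) := by
        rw [← Real.exp_add, mul_left_comm, ← Real.exp_add]; congr 2; ring
    _ ≤ _ := by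
        gcongr
        nlinarith

/-- With high probability the fourth-order form concentrates uniformly over the incoherent vectors
and around the signal. -/
lemma design_real_not_concentrated_le {m : ℕ} (hm : 3 ≤ m) (hL : 1 ≤ Real.log m) (hN : 1 ≤ N)
    (hNm : N ≤ m) (hsample : 64 * N * Real.log m ≤ m) {xs : Fin N → ℝ} (hxs : nrm xs = 1) {c : ℝ}
    (hc : 8 ≤ c) :
    (design m N).real {a | ¬ ((∀ i, |dotp (a i) xs| ≤ c * √(Real.log m)) ∧
      ∀ z u : Fin N → ℝ, nrm z ≤ 1 → nrm u ≤ 1 → (∀ i, |dotp (a i) z| ≤ c * √(Real.log m)) →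
        |quartic a z u - quarticMean z u| ≤
          (2082 * c ^ 2 + 16524) * √(N * Real.log m ^ 3 / m))} ≤
      6 * Real.exp (-(14 * Real.log m)) := by
  have hm0 : (0 : ℝ) < m := by exact_mod_cast (by omega : 0 < m)
  have hm1 : (1 : ℝ) ≤ m := by exact_mod_cast (by omega : 1 ≤ m)
  have hN' : (1 : ℝ) ≤ N := by exact_mod_cast hN
  have hNm' : (N : ℝ) ≤ m := by exact_mod_cast hNm
  obtain ⟨S, hcard, hS, hnet⟩ := exists_net N (M := m ^ 9) (by positivity)
  set L := Real.log m with hLdef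
  set R := c * √L with hR
  have hsL : 1 ≤ √L := Real.one_le_sqrt.2 hL
  have hLm : √L ≤ m := Real.sqrt_le_iff.2 ⟨hm0.le, by
    have := Real.log_le_sub_one_of_pos hm0
    nlinarith⟩
  have hR0 : 0 < R := by positivity
  have hRsq : R ^ 2 = c ^ 2 * L := by rw [hR, mul_pow, Real.sq_sqrt (by linarith)]
  set δ := √(N * L ^ 3 / m) with hδ
  have hδL : L * √(N * L / m) = δ := by
    rw [hδ, ← Real.sqrt_sq (by linarith : 0 ≤ L), ← Real.sqrt_mul (sq_nonneg _),
      Real.sqrt_sq (by linarith : 0 ≤ L)]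
    congr 1
    ring
  have hδm : 1 / (m : ℝ) ≤ δ := by
    refine Real.le_sqrt_of_sq_le ?_
    have h1 : (1 : ℝ) ≤ N * L ^ 3 := one_le_mul_of_one_le_of_one_le hN' (one_le_pow₀ hL)
    calc (1 / (m : ℝ)) ^ 2 = 1 / m * (1 / m) := by ring
      _ ≤ N * L ^ 3 * (1 / m) := by
          gcongr
          exact (div_le_one_of_le₀ hm1 hm0.le).trans h1
      _ = _ := by ring
  have hsub : {a : Fin m → Fin N → ℝ | ¬ ((∀ i, |dotp (a i) xs| ≤ R) ∧
      ∀ z u : Fin N → ℝ, nrm z ≤ 1 → nrm u ≤ 1 → (∀ i, |dotp (a i) z| ≤ R) →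
        |quartic a z u - quarticMean z u| ≤ (2082 * c ^ 2 + 16524) * δ)} ⊆
      {a | ∃ i, (∃ j, 8 * √L ≤ |a i j|) ∨ 8 * √L ≤ |dotp (a i) xs|} ∪
      {a | ∃ z ∈ S, ∃ u ∈ S, R ^ 2 * (2082 * √(N * L / m)) ≤ |truncQuartic R a z u -
        ∫ x, truncSq R (dotp x z) * dotp x u ^ 2 ∂(PR.stdGaussian N)|} := by
    intro a ha
    by_contra hcon
    simp only [Set.mem_union, Set.mem_ofPred_eq, not_or, not_exists, not_and, not_le] at hcon
    obtain ⟨h1, h2⟩ := hcon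
    refine ha ⟨fun i => (h1 i).2.le.trans (by rw [hR]; gcongr), fun z u hz hu hinc => ?_⟩
    have hentry : ∀ i j, |a i j| ≤ 8 * (m : ℝ) := fun i j =>
      ((h1 i).1 j).le.trans (by gcongr)
    have key := abs_quartic_sub_quarticMean_le (b := 8 * (m : ℝ)) (ε := 1 / ((m ^ 9 : ℕ) : ℝ))
      (t := R ^ 2 * (2082 * √(N * L / m))) (by positivity) (by positivity) hentry hS hnet
      (fun z hz u hu => (h2 z hz u hu).le) hz hu hinc
    refine key.trans ?_
    have k1 : 4 * (N * (8 * (m : ℝ))) ^ 4 * (1 / ((m ^ 9 : ℕ) : ℝ)) ≤ 16384 * δ := by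
      calc _ ≤ 4 * (m * (8 * (m : ℝ))) ^ 4 * (1 / ((m ^ 9 : ℕ) : ℝ)) := by gcongr
        _ = 16384 * (1 / m) := by push_cast; field_simp; norm_num
        _ ≤ _ := by gcongr
    have k2 : R ^ 2 * (2082 * √(N * L / m)) = 2082 * c ^ 2 * δ := by
      rw [hRsq, ← hδL]; ring
    have k3 : 128 * Real.exp (-(R ^ 2 / 8)) ≤ 128 * δ := by
      have : Real.exp (-(R ^ 2 / 8)) ≤ 1 / m := by
        rw [one_div, ← Real.exp_log hm0, ← Real.exp_neg, Real.exp_le_exp, ← hLdef, hRsq]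
        have : 8 * L ≤ c ^ 2 * L := by gcongr; nlinarith
        linarith
      linarith
    have k4 : 12 * N * (1 / ((m ^ 9 : ℕ) : ℝ)) ≤ 12 * δ := by
      calc 12 * N * (1 / ((m ^ 9 : ℕ) : ℝ)) ≤ 12 * m * (1 / ((m ^ 9 : ℕ) : ℝ)) := by gcongr
        _ = 12 * (1 / (m : ℝ) ^ 8) := by push_cast; field_simp
        _ ≤ 12 * (1 / m) := by
            gcongr
            exact le_self_pow₀ hm1 (by norm_num)
        _ ≤ _ := by gcongr
    linarith
  calc _ ≤ _ := measureReal_mono hsub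
    _ ≤ _ := measureReal_union_le _ _
    _ ≤ 4 * Real.exp (-(14 * L)) + 2 * Real.exp (-(14 * L)) :=
        add_le_add (design_real_exists_large_le hL hN hNm hxs)
          (design_real_exists_net_dev_le hm hL hN hsample hR0 hcard hS)
    _ = _ := by ring

lemma ofReal_one_sub_le_measure {Ω : Type*} [MeasurableSpace Ω] {μ : Measure Ω}
    [IsProbabilityMeasure μ] {s : Set Ω} {p : ℝ} (h : μ.real sᶜ ≤ p) :
    ENNReal.ofReal (1 - p) ≤ μ s := by
  rw [← ofReal_measureReal (measure_ne_top μ s)]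
  refine ENNReal.ofReal_le_ofReal ?_
  have := measureReal_union_le (μ := μ) s sᶜ
  rw [Set.union_compl_self, probReal_univ] at this
  linarith

end Main

end PR

/-- **Uniform control of `I − η ∇²f`.** Uniformly over all `z` incoherent with the design and
all sufficiently small stepsizes `η`, `Iₙ − η∇²f(z)` is close, in spectral norm, to
`(1 − 3η‖z‖² + η) Iₙ + 2η x♮x♮ᵀ − 6η zzᵀ`; moreover `‖∇²f(z)‖ ≤ 10‖z‖² + 4`. -/
theorem hessian_uniform_control :
    ∀ c₀ : ℝ, 1 < c₀ →
      ∃ c₁ > (0 : ℝ), ∃ c₂ > (0 : ℝ), ∃ K > (0 : ℝ), ∃ Cp > (0 : ℝ),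
        ∀ (n m : ℕ) (xs : Fin n → ℝ), PR.nrm xs = 1 →
          (m : ℝ) > c₁ * n * Real.log m ^ 3 →
          PR.design m n
            {a : Fin m → Fin n → ℝ |
              ∀ z : Fin n → ℝ,
                (∀ i, |PR.dotp (a i) z| ≤ c₀ * Real.sqrt (Real.log m) * PR.nrm z) →
                (∀ η : ℝ, 0 < η → η < c₂ / max (PR.nrm z ^ 2) 1 →
                  PR.opN (((1 : Matrix (Fin n) (Fin n) ℝ) - η • PR.hess a xs z) -
                      ((1 - 3 * η * PR.nrm z ^ 2 + η) • (1 : Matrix (Fin n) (Fin n) ℝ) +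
                        (2 * η) • PR.outer xs - (6 * η) • PR.outer z)) ≤
                    K * Real.sqrt (n * Real.log m ^ 3 / m) * max (PR.nrm z ^ 2) 1) ∧
                PR.opN (PR.hess a xs z) ≤ 10 * PR.nrm z ^ 2 + 4} ≥
          ENNReal.ofReal (1 - Cp * (m : ℝ) ^ (-10 : ℤ)) := by
  intro c₀ hc₀
  set c := max c₀ 8
  set K₀ := 2082 * c ^ 2 + 16524
  have hc8 : 8 ≤ c := le_max_right _ _
  have hK₀ : 0 < K₀ := by positivity
  refine ⟨64 + (4 * K₀) ^ 2, by positivity, 1, one_pos, 4 * K₀, by positivity, 1024, by norm_num,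
    fun n m xs hxs hm => ?_⟩
  have hn : 1 ≤ n := by
    rcases Nat.eq_zero_or_pos n with h | h
    · subst h; simp [PR.nrm] at hxs
    · exact h
  have hn' : (1 : ℝ) ≤ n := by exact_mod_cast hn
  rcases lt_or_ge m 3 with hm3 | hm3
  · have hm0 : m ≠ 0 := by
      rintro rfl
      simp at hm
    have : 1 - 1024 * (m : ℝ) ^ (-10 : ℤ) ≤ 0 := by
      have : m = 1 ∨ m = 2 := by omega
      rcases this with rfl | rfl <;> norm_num
    rw [ENNReal.ofReal_of_nonpos this]
    exact zero_le
  have hm3' : (3 : ℝ) ≤ m := by exact_mod_cast hm3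
  have hm0 : (0 : ℝ) < m := by linarith
  have hL : 1 ≤ Real.log m := by
    rw [Real.le_log_iff_exp_le hm0]
    linarith [Real.exp_one_lt_d9]
  set L := Real.log m with hLdef
  have hL3 : L ≤ L ^ 3 := le_self_pow₀ hL (by norm_num)
  have hnL : (n : ℝ) ≤ n * L ^ 3 := le_mul_of_one_le_right (by linarith) (hL.trans hL3)
  have hnL' : n * L ≤ n * L ^ 3 := by gcongr
  have hsample : 64 * (n * L ^ 3) + (4 * K₀) ^ 2 * (n * L ^ 3) < m := by linarith
  have hpos : 0 ≤ (4 * K₀) ^ 2 * (n * L ^ 3) := by positivity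
  have hnm : n ≤ m := by
    have : (n : ℝ) ≤ m := by linarith
    exact_mod_cast this
  have h64 : 64 * n * L ≤ m := by linarith
  have hδ : 4 * (K₀ * √(n * L ^ 3 / m)) ≤ 1 := by
    have : √((4 * K₀) ^ 2 * (n * L ^ 3 / m)) ≤ 1 := by
      rw [Real.sqrt_le_one, ← mul_div_assoc, div_le_one hm0]
      linarith
    rwa [Real.sqrt_mul (sq_nonneg _), Real.sqrt_sq (by positivity), mul_assoc] at this
  have hfail := PR.design_real_not_concentrated_le hm3 hL hn hnm h64 hxs hc8
  refine PR.ofReal_one_sub_le_measure ((measureReal_mono fun a ha => ?_).trans (hfail.trans ?_))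
  · intro ⟨hx, hconc⟩
    refine ha fun z hz => ?_
    have hlift := fun w => PR.abs_quartic_sub_le_of_unit hconc w
    have h := PR.hess_control (by positivity) hδ hxs
      (fun u => hlift z u fun i => (hz i).trans (by
        have := PR.nrm_nonneg z
        gcongr
        exact le_max_left _ _))
      (fun u => hlift xs u fun i => by rw [hxs, mul_one]; exact hx i)
    rw [← mul_assoc] at h
    exact h
  · have e : (m : ℝ) ^ (-10 : ℤ) = Real.exp (-(10 * L)) := by
      rw [Real.exp_neg, hLdef, mul_comm, Real.exp_mul, Real.exp_log hm0, zpow_neg]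
      norm_cast
    rw [e]
    have : Real.exp (-(14 * L)) ≤ Real.exp (-(10 * L)) := Real.exp_le_exp.2 (by linarith)
    have := Real.exp_pos (-(10 * L))
    linarith
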